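/- Let T be a tree on the vertex set {1,…,n} and let c be an n-cycle of {1,…,n}; write v_k = c^{k−1}(1) for k = 1,…,n, so that c = (v_1, v_2, …, v_n). Then some edge ordering of T has product c if and only if the diagram of (T, c) is crossing-free, i.e., there do not exist two edges {v_a, v_b} and {v_p, v_q} of T with 1 ≤ a < p < b < q ≤ n. (Theorem 4.1.) -/

import Mathlib

/-- The transposition of `Sₙ` corresponding to an edge (an unordered pair) of a graph
on the vertex set `Fin n`. -/
def edgePerm {n : ℕ} (e : Sym2 (Fin n)) : Equiv.Perm (Fin n) :=
  Sym2.lift ⟨fun i j => Equiv.swap i j, fun i j => Equiv.swap_comm i j⟩ e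

/-- The product of the transpositions of a list of edges, the first edge applied first. -/
def listProd {n : ℕ} (l : List (Sym2 (Fin n))) : Equiv.Perm (Fin n) :=
  (l.map edgePerm).reverse.prod

/-- `l` is an edge ordering of the graph `T`: a duplicate-free list containing
exactly the edges of `T`. -/
def IsEdgeOrdering {n : ℕ} (T : SimpleGraph (Fin n)) (l : List (Sym2 (Fin n))) : Prop :=
  l.Nodup ∧ ∀ e, e ∈ l ↔ e ∈ T.edgeSet

section NoncrossingTrees

open List

variable {V : Type*}

/-- No two edges of `G` cross when the entries of `L` are placed around a circle in list order. -/
def CrossingFree (G : SimpleGraph V) (L : List V) : Prop :=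
  ∀ p q r s, [p, q, r, s] <+ L → G.Adj p r → ¬ G.Adj q s

/-- `x :: A` lists, in cyclic order, a cycle of `c` whose support is the connected component of
`x` in `G`, and `G` is crossing-free along this cycle. -/
structure IsComponentCycle (G : SimpleGraph V) (c : Equiv.Perm V) (x : V) (A : List V) :
    Prop where
  nodup : (x :: A).Nodup
  chain : (x :: (A ++ [x])).IsChain fun a b => c a = b
  mem_iff : ∀ z, z ∈ x :: A ↔ G.Reachable x z
  crossingFree : CrossingFree G (x :: A)

theorem CrossingFree.rotate {G : SimpleGraph V} {U W : List V} (h : CrossingFree G (U ++ W)) :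
    CrossingFree G (W ++ U) := by
  intro p q r s hs hpr hqs
  obtain ⟨l₁, l₂, he, h₁, h₂⟩ := sublist_append_iff.1 hs
  have key : l₂ ++ l₁ <+ U ++ W := h₂.append h₁
  rcases l₁ with _ | ⟨a, _ | ⟨b, _ | ⟨d, _ | ⟨e, l⟩⟩⟩⟩
  · simp at he; subst he
    exact h _ _ _ _ key hpr hqs
  · simp at he; obtain ⟨rfl, rfl⟩ := he
    exact h _ _ _ _ key hqs hpr.symm
  · simp at he; obtain ⟨rfl, rfl, rfl⟩ := he
    exact h _ _ _ _ key hpr.symm hqs.symm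
  · simp at he; obtain ⟨rfl, rfl, rfl, rfl⟩ := he
    exact h _ _ _ _ key hqs.symm hpr
  · simp at he; obtain ⟨rfl, rfl, rfl, rfl, rfl, rfl⟩ := he
    exact h _ _ _ _ key hpr hqs

theorem CrossingFree.mono {G H : SimpleGraph V} {L M : List V} (h : CrossingFree G L)
    (hG : H ≤ G) (hL : M <+ L) : CrossingFree H M :=
  fun p q r s hs hpr hqs => h p q r s (hs.trans hL) (hG hpr) (hG hqs)

theorem CrossingFree.merge {G H : SimpleGraph V} {x y : V} {A B : List V}
    (hnd : (x :: (B ++ y :: A)).Nodup)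
    (hG : ∀ p q, G.Adj p q → H.Adj p q ∨ (p = x ∧ q = y) ∨ (p = y ∧ q = x))
    (hAB : ∀ p ∈ x :: A, ∀ q ∈ y :: B, ¬ H.Adj p q)
    (hA : CrossingFree H (x :: A)) (hB : CrossingFree H (y :: B)) :
    CrossingFree G (x :: (B ++ y :: A)) := by
  intro p q r s hs hpr hqs
  have hnds := hs.nodup hnd
  obtain ⟨l₁, l₂, he, h₁, h₂⟩ :=
    sublist_append_iff.1 (show [p, q, r, s] <+ (x :: B) ++ (y :: A) from hs)
  have hBA : ∀ p ∈ x :: A, ∀ q ∈ y :: B, ¬ H.Adj q p := fun p hp q hq h => hAB p hp q hq h.symm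
  have m₁ := h₁.subset
  have m₂ := h₂.subset
  have hpr' := hG _ _ hpr
  have hqs' := hG _ _ hqs
  rcases l₁ with _ | ⟨a, _ | ⟨b, _ | ⟨d, _ | ⟨e, l⟩⟩⟩⟩
  · simp at he; subst he
    rcases sublist_cons_iff.1 h₂ with h | ⟨t, ht, h⟩
    · have := hA p q r s (h.trans (sublist_cons_self _ _))
      have m := h.subset
      grind
    · simp at ht; obtain ⟨rfl, rfl⟩ := ht
      have m := h.subset
      grind
  · simp at he; obtain ⟨rfl, rfl⟩ := he
    rcases sublist_cons_iff.1 h₂ with h | ⟨t, ht, h⟩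
    · have := hA x q r s (h.cons_cons _)
      have m := h.subset
      grind
    · simp at ht; obtain ⟨rfl, rfl⟩ := ht
      have m := h.subset
      grind
  · simp at he; obtain ⟨rfl, rfl, rfl⟩ := he
    grind
  · simp at he; obtain ⟨rfl, rfl, rfl, rfl⟩ := he
    rcases sublist_cons_iff.1 h₁ with h | ⟨t, ht, h⟩
    · have := hB y p q r (h.cons_cons _)
      have m := h.subset
      have := hqs.symm
      have := hqs'.imp_left SimpleGraph.Adj.symm
      grind
    · simp at ht; obtain ⟨rfl, rfl⟩ := ht
      have m := h.subset
      grind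
  · simp at he; obtain ⟨rfl, rfl, rfl, rfl, rfl, rfl⟩ := he
    rcases sublist_cons_iff.1 h₁ with h | ⟨t, ht, h⟩
    · have := hB p q r s (h.trans (sublist_cons_self _ _))
      have m := h.subset
      grind
    · simp at ht; obtain ⟨rfl, rfl⟩ := ht
      have m := h.subset
      grind

theorem IsComponentCycle.rotate {G : SimpleGraph V} {c : Equiv.Perm V} {x y : V} {U W : List V}
    (h : IsComponentCycle G c x (U ++ y :: W)) : IsComponentCycle G c y (W ++ x :: U) where
  nodup := by
    have := h.nodup
    rw [← cons_append] at this ⊢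
    exact nodup_append_comm.1 this
  chain := by
    have := h.chain
    rw [append_assoc, cons_append, ← cons_append, isChain_split] at this
    rw [append_assoc, cons_append, ← cons_append, isChain_split]
    exact ⟨this.2, this.1⟩
  mem_iff z := by
    have hy : G.Reachable x y := (h.mem_iff y).1 (by simp)
    have : G.Reachable y z ↔ G.Reachable x z := ⟨hy.trans, hy.symm.trans⟩
    rw [this, ← h.mem_iff]
    simp; tauto
  crossingFree := CrossingFree.rotate (U := x :: U) (W := y :: W) h.crossingFree

theorem isChain_apply_congr {c d : V → V} {l : List V} {z : V}
    (h : (l ++ [z]).IsChain fun a b => c a = b) (hcd : ∀ a ∈ l, c a = d a) :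
    (l ++ [z]).IsChain fun a b => d a = b := by
  induction l with
  | nil => simp
  | cons a l ih => cases l <;> simp_all

theorem isChain_mul_swap [DecidableEq V] {c : Equiv.Perm V} {x y z : V} {B : List V}
    (h : (y :: (B ++ [z])).IsChain fun a b => c a = b) (hx : x ∉ B) (hy : y ∉ B) :
    (x :: (B ++ [z])).IsChain fun a b => (c * Equiv.swap x y) a = b := by
  have h2 : (B ++ [z]).IsChain fun a b => (c * Equiv.swap x y) a = b := by
    refine isChain_apply_congr h.tail fun a ha => ?_
    rw [Equiv.Perm.mul_apply, Equiv.swap_apply_of_ne_of_ne] <;> grind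
  cases B <;> simp_all

theorem isChain_apply_unique {c : V → V} {a x : V} {A B : List V}
    (hA : (a :: (A ++ [x])).IsChain fun a b => c a = b)
    (hB : (a :: (B ++ [x])).IsChain fun a b => c a = b) (hxA : x ∉ A) (hxB : x ∉ B) : A = B := by
  induction A generalizing a B with
  | nil => cases B <;> simp_all
  | cons b A ih =>
    cases B with
    | nil => simp_all
    | cons d B =>
      simp only [cons_append, isChain_cons_cons, mem_cons, not_or] at hA hB hxA hxB
      obtain rfl : b = d := hA.1.symm.trans hB.1
      rw [ih hA.2 hB.2 hxA.2 hxB.2]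

theorem IsComponentCycle.exists_of_mem {G : SimpleGraph V} {c : Equiv.Perm V} {x y : V}
    {A : List V} (h : IsComponentCycle G c x A) (hy : y ∈ x :: A) :
    ∃ B, IsComponentCycle G c y B := by
  rcases mem_cons.1 hy with rfl | hy
  · exact ⟨A, h⟩
  · obtain ⟨U, W, rfl⟩ := append_of_mem hy
    exact ⟨_, h.rotate⟩

theorem reachable_iff_of_adj {G : SimpleGraph V} {x y : V} (hxy : G.Adj x y) (z : V) :
    G.Reachable x z ↔
      (G.deleteEdges {s(x, y)}).Reachable x z ∨ (G.deleteEdges {s(x, y)}).Reachable y z := by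
  have hle := G.deleteEdges_le {s(x, y)}
  refine ⟨fun h => ?_, fun h => h.elim (·.mono hle) fun h => hxy.reachable.trans (h.mono hle)⟩
  rw [SimpleGraph.reachable_iff_reflTransGen] at h
  induction h with
  | refl => exact .inl .rfl
  | @tail b d _ hbd ih =>
    by_cases he : s(b, d) = s(x, y)
    · rcases Sym2.eq_iff.1 he with ⟨rfl, rfl⟩ | ⟨rfl, rfl⟩
      · exact .inr .rfl
      · exact .inl .rfl
    · have : (G.deleteEdges {s(x, y)}).Adj b d := by simp_all
      exact ih.imp (·.trans this.reachable) (·.trans this.reachable)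

theorem IsComponentCycle.merge [DecidableEq V] {G : SimpleGraph V} {c : Equiv.Perm V} {x y : V}
    {A B : List V} (hxy : G.Adj x y) (hnr : ¬ (G.deleteEdges {s(x, y)}).Reachable x y)
    (hA : IsComponentCycle (G.deleteEdges {s(x, y)}) c x A)
    (hB : IsComponentCycle (G.deleteEdges {s(x, y)}) c y B) :
    IsComponentCycle G (c * Equiv.swap x y) x (B ++ y :: A) := by
  have hdisj : ∀ p ∈ x :: A, p ∉ y :: B := fun p hp hq =>
    hnr (((hA.mem_iff p).1 hp).trans ((hB.mem_iff p).1 hq).symm)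
  have hAB : ∀ p ∈ x :: A, ∀ q ∈ y :: B, ¬ (G.deleteEdges {s(x, y)}).Adj p q :=
    fun p hp q hq h => hdisj q ((hA.mem_iff q).2 (((hA.mem_iff p).1 hp).trans h.reachable)) hq
  have hnd : (x :: (B ++ y :: A)).Nodup := by
    have := hA.nodup
    have := hB.nodup
    simp only [nodup_cons, nodup_append, mem_append, mem_cons] at *
    grind
  refine ⟨hnd, ?_, fun z => ?_, ?_⟩
  · rw [append_assoc, cons_append, ← cons_append, isChain_split]
    have h1 := hA.nodup
    have h2 := hB.nodup
    constructor
    · exact isChain_mul_swap hB.chain (by grind) (by grind)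
    · rw [Equiv.swap_comm]
      exact isChain_mul_swap hA.chain (by grind) (by grind)
  · rw [reachable_iff_of_adj hxy, ← hA.mem_iff, ← hB.mem_iff]
    simp; tauto
  · refine CrossingFree.merge hnd (fun p q h => ?_) hAB hA.crossingFree hB.crossingFree
    by_cases he : s(p, q) = s(x, y)
    · exact .inr (by simpa using he)
    · exact .inl (by simp_all)

/-- Every vertex lies on a cycle of `c` filling its component of `G` without crossings. -/
def HasComponentCycles (G : SimpleGraph V) (c : Equiv.Perm V) : Prop :=
  ∀ x, ∃ A, IsComponentCycle G c x A

/-- Passing to another graph and permutation that agree on the component at hand. -/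
theorem IsComponentCycle.congr {G H : SimpleGraph V} {c d : Equiv.Perm V} {z : V} {A : List V}
    (h : IsComponentCycle G c z A) (hcd : ∀ a ∈ z :: A, c a = d a)
    (hr : ∀ w, G.Reachable z w ↔ H.Reachable z w)
    (hGH : ∀ p ∈ z :: A, ∀ q, H.Adj p q → G.Adj p q) : IsComponentCycle H d z A where
  nodup := h.nodup
  chain := isChain_apply_congr (l := z :: A) h.chain hcd
  mem_iff w := (h.mem_iff w).trans (hr w)
  crossingFree p q r s hs hpr hqs :=
    h.crossingFree p q r s hs (hGH p (hs.subset (by simp)) r hpr)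
      (hGH q (hs.subset (by simp)) s hqs)

theorem reachable_deleteEdges_iff {G : SimpleGraph V} {x y z w : V} (hxy : G.Adj x y)
    (hz : ¬ G.Reachable x z) :
    (G.deleteEdges {s(x, y)}).Reachable z w ↔ G.Reachable z w := by
  refine ⟨(·.mono (G.deleteEdges_le _)), fun h => ?_⟩
  rw [SimpleGraph.reachable_iff_reflTransGen] at h
  induction h with
  | refl => exact .rfl
  | @tail b d hb hbd ih =>
    rw [← SimpleGraph.reachable_iff_reflTransGen] at hb
    refine ih.trans (SimpleGraph.Adj.reachable ?_)
    rw [SimpleGraph.deleteEdges_adj]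
    refine ⟨hbd, fun he => hz ?_⟩
    rcases Sym2.eq_iff.1 he with ⟨rfl, rfl⟩ | ⟨rfl, rfl⟩
    · exact hb.symm
    · exact hxy.reachable.trans hb.symm

theorem HasComponentCycles.merge [DecidableEq V] {G : SimpleGraph V} {c : Equiv.Perm V} {x y : V}
    (hxy : G.Adj x y) (hnr : ¬ (G.deleteEdges {s(x, y)}).Reachable x y)
    (h : HasComponentCycles (G.deleteEdges {s(x, y)}) c) :
    HasComponentCycles G (c * Equiv.swap x y) := by
  intro z
  obtain ⟨A, hA⟩ := h x
  obtain ⟨B, hB⟩ := h y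
  have hx := hA.merge hxy hnr hB
  by_cases hz : G.Reachable x z
  · exact hx.exists_of_mem ((hx.mem_iff z).2 hz)
  · obtain ⟨D, hD⟩ := h z
    have hr := fun w => reachable_deleteEdges_iff (w := w) hxy hz
    have hne : ∀ a ∈ z :: D, a ≠ x ∧ a ≠ y := by
      intro a ha
      rw [hD.mem_iff, hr] at ha
      exact ⟨fun h => hz (h ▸ ha.symm), fun h => hz (hxy.reachable.trans (h ▸ ha.symm))⟩
    refine ⟨D, hD.congr (fun a ha => ?_) hr fun p hp q hpq => ?_⟩
    · rw [Equiv.Perm.mul_apply, Equiv.swap_apply_of_ne_of_ne (hne a ha).1 (hne a ha).2]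
    · have := hne p hp
      simp [hpq]
      tauto

theorem IsComponentCycle.split [DecidableEq V] {G : SimpleGraph V} {c : Equiv.Perm V} {x y : V}
    {A B : List V} (h : IsComponentCycle G c x (B ++ y :: A)) (hxy : G.Adj x y)
    (hxB : ∀ b ∈ B, ¬ G.Adj x b) (hyA : ∀ a ∈ A, ¬ G.Adj y a) :
    IsComponentCycle (G.deleteEdges {s(x, y)}) (c * Equiv.swap x y) x A := by
  have hnd := h.nodup
  have hdisj : ∀ p ∈ x :: A, p ∉ y :: B := by
    simp only [nodup_cons, nodup_append, mem_append, mem_cons] at *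
    grind
  have hcross : ∀ p ∈ x :: A, ∀ q ∈ y :: B, ¬ (G.deleteEdges {s(x, y)}).Adj p q := by
    intro p hp q hq hpq
    rw [SimpleGraph.deleteEdges_adj] at hpq
    obtain ⟨hadj, hne⟩ := hpq
    rcases mem_cons.1 hp with rfl | hp
    · rcases mem_cons.1 hq with rfl | hq
      · exact hne rfl
      · exact hxB _ hq hadj
    · rcases mem_cons.1 hq with rfl | hq
      · exact hyA _ hp hadj.symm
      · refine h.crossingFree x q y p (Sublist.cons_cons _ ?_) hxy hadj.symm
        exact (singleton_sublist.2 hq).append ((singleton_sublist.2 hp).cons_cons y)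
  have hle := G.deleteEdges_le {s(x, y)}
  have hmem : ∀ z, G.Reachable x z ↔ z ∈ x :: A ∨ z ∈ y :: B := fun z => by
    rw [← h.mem_iff]; simp; tauto
  have hclosed : ∀ S R : List V, (∀ z, G.Reachable x z ↔ z ∈ S ∨ z ∈ R) →
      (∀ p ∈ S, ∀ q ∈ R, ¬ (G.deleteEdges {s(x, y)}).Adj p q) → ∀ u ∈ S, ∀ z,
      (G.deleteEdges {s(x, y)}).Reachable u z → z ∈ S := by
    intro S R hSR hno u hu z hz
    rw [SimpleGraph.reachable_iff_reflTransGen] at hz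
    induction hz with
    | refl => exact hu
    | @tail b d _ hbd ih =>
      refine ((hSR d).1 (((hSR b).2 (.inl ih)).trans (hle hbd).reachable)).resolve_right
        fun hd => hno b ih d hd hbd
  refine ⟨hnd.sublist (by simp), ?_, fun z => ⟨fun hz => ?_, fun hz => ?_⟩,
    h.crossingFree.mono hle (by simp)⟩
  · have := h.chain
    rw [append_assoc, cons_append, ← cons_append, isChain_split] at this
    exact isChain_mul_swap this.2 (by simp at hnd; grind) (by simp at hnd; grind)
  · refine ((reachable_iff_of_adj hxy z).1 ((hmem z).2 (.inl hz))).resolve_right fun hyz => ?_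
    exact hdisj z hz (hclosed (y :: B) (x :: A) (fun z => (hmem z).trans or_comm)
      (fun p hp q hq hpq => hcross q hq p hp hpq.symm) y (by simp) z hyz)
  · exact hclosed _ _ hmem hcross x (by simp) z hz

theorem HasComponentCycles.split [DecidableEq V] {G : SimpleGraph V} {c : Equiv.Perm V} {x y : V}
    {A B : List V} (hG : HasComponentCycles G c) (h : IsComponentCycle G c x (B ++ y :: A))
    (hxy : G.Adj x y) (hxB : ∀ b ∈ B, ¬ G.Adj x b) (hyA : ∀ a ∈ A, ¬ G.Adj y a) :
    HasComponentCycles (G.deleteEdges {s(x, y)}) (c * Equiv.swap x y) := by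
  intro z
  have hx := h.split hxy hxB hyA
  have hy : IsComponentCycle (G.deleteEdges {s(x, y)}) (c * Equiv.swap x y) y B := by
    have := h.rotate.split hxy.symm hyA hxB
    rwa [Sym2.eq_swap, Equiv.swap_comm]
  by_cases hz : G.Reachable x z
  · rcases (reachable_iff_of_adj hxy z).1 hz with h | h
    · exact hx.exists_of_mem ((hx.mem_iff z).2 h)
    · exact hy.exists_of_mem ((hy.mem_iff z).2 h)
  · obtain ⟨D, hD⟩ := hG z
    have hr := fun w => reachable_deleteEdges_iff (w := w) hxy hz
    refine ⟨D, hD.congr (fun a ha => ?_) (fun w => (hr w).symm)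
      fun p hp q hpq => G.deleteEdges_le _ hpq⟩
    rw [hD.mem_iff] at ha
    rw [Equiv.Perm.mul_apply, Equiv.swap_apply_of_ne_of_ne]
    · exact fun h => hz (h ▸ ha.symm)
    · exact fun h => hz (hxy.reachable.trans (h ▸ ha.symm))

/-- A choice of a neighbour at every non-isolated vertex of a nonempty finite forest selects some
edge from both of its ends. -/
theorem exists_mutual_neighbor [Finite V] {G : SimpleGraph V} (hG : G.IsAcyclic) {r s : V}
    (hrs : G.Adj r s) (f : V → V) (hf : ∀ v w, G.Adj v w → G.Adj v (f v)) :
    ∃ v, G.Adj v (f v) ∧ f (f v) = v := by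
  classical
  have := Fintype.ofFinite V
  have : Nonempty V := ⟨r⟩
  obtain ⟨T, hGT, -, hT⟩ := SimpleGraph.Connected.exists_isTree_le_of_le_of_isAcyclic
    (G := (⊤ : SimpleGraph V)) SimpleGraph.connected_top le_top hG
  have hcloser : ∀ v, v ≠ r → ∃ w, T.Adj v w ∧ T.dist w r < T.dist v r := by
    intro v hv
    obtain ⟨p, hp⟩ := (hT.connected v r).exists_walk_length_eq_dist
    cases p with
    | nil => exact absurd rfl hv
    | @cons _ w _ h p =>
      refine ⟨w, h, ?_⟩
      have := SimpleGraph.dist_le p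
      rw [SimpleGraph.Walk.length_cons] at hp
      omega
  have hg : ∀ v, ∃ w, T.Adj v w ∧ ((G.Adj v w ∧ w = f v) ∨
      ((∀ u, ¬ G.Adj v u) ∧ T.dist w r < T.dist v r)) := by
    intro v
    by_cases hv : ∃ w, G.Adj v w
    · obtain ⟨w, hw⟩ := hv
      exact ⟨f v, hGT (hf v w hw), .inl ⟨hf v w hw, rfl⟩⟩
    · push Not at hv
      obtain ⟨w, hw, hd⟩ := hcloser v (by rintro rfl; exact hv s hrs)
      exact ⟨w, hw, .inr ⟨hv, hd⟩⟩
  choose g hgT hg using hg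
  have hcard : T.edgeFinset.card < (Finset.univ : Finset V).card := by
    have := hT.card_edgeFinset
    rw [Finset.card_univ]
    omega
  obtain ⟨v, -, w, -, hne, he⟩ := Finset.exists_ne_map_eq_of_card_lt_of_maps_to hcard
    (f := fun v => s(v, g v)) (fun v _ => by simpa using hgT v)
  have he' : g v = w ∧ g w = v := by
    rcases Sym2.eq_iff.1 he with h | h
    · exact absurd h.1 hne
    · exact ⟨h.2, h.1.symm⟩
  obtain ⟨h1, h2⟩ := he'
  have hv := hg v
  have hw := hg w
  rw [h1] at hv
  rw [h2] at hw
  rcases hv with ⟨hv, hv'⟩ | ⟨hv, hv'⟩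
  · rcases hw with ⟨hw, hw'⟩ | ⟨hw, hw'⟩
    · exact ⟨v, hv' ▸ hv, by rw [← hv', ← hw']⟩
    · exact absurd hv.symm (hw v)
  · rcases hw with ⟨hw, hw'⟩ | ⟨hw, hw'⟩
    · exact absurd hw.symm (hv w)
    · omega

theorem exists_eq_append_cons_first {P : V → Prop} {A : List V} (h : ∃ a ∈ A, P a) :
    ∃ B y C, A = B ++ y :: C ∧ P y ∧ ∀ b ∈ B, ¬ P b := by
  classical
  obtain ⟨y, hy⟩ := Option.isSome_iff_exists.1
    (find?_isSome (p := fun a => decide (P a)) (xs := A) |>.2 (by simpa using h))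
  obtain ⟨hPy, B, C, rfl, hB⟩ := find?_eq_some_iff_append.1 hy
  exact ⟨B, y, C, rfl, by simpa using hPy, by simpa using hB⟩

theorem HasComponentCycles.exists_mutual_edge [Finite V] {G : SimpleGraph V}
    {c : Equiv.Perm V} (hG : HasComponentCycles G c) (hac : G.IsAcyclic) {r s : V}
    (hrs : G.Adj r s) : ∃ x y A B, IsComponentCycle G c x (B ++ y :: A) ∧ G.Adj x y ∧
      (∀ b ∈ B, ¬ G.Adj x b) ∧ ∀ a ∈ A, ¬ G.Adj y a := by
  have hfirst : ∀ x, ∃ y, ∀ w, G.Adj x w → ∃ B C, IsComponentCycle G c x (B ++ y :: C) ∧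
      G.Adj x y ∧ ∀ b ∈ B, ¬ G.Adj x b := by
    intro x
    obtain ⟨A, hA⟩ := hG x
    by_cases hx : ∃ w, G.Adj x w
    · obtain ⟨w, hw⟩ := hx
      have hwA : w ∈ A := by
        have := (hA.mem_iff w).2 hw.reachable
        exact (mem_cons.1 this).resolve_left hw.ne'
      obtain ⟨B, y, C, rfl, hy, hB⟩ := exists_eq_append_cons_first (P := G.Adj x) ⟨w, hwA, hw⟩
      exact ⟨y, fun _ _ => ⟨B, C, hA, hy, hB⟩⟩
    · exact ⟨x, fun w hw => absurd ⟨w, hw⟩ hx⟩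
  choose f hf using hfirst
  obtain ⟨x, hx, hfx⟩ := exists_mutual_neighbor hac hrs f fun v w hvw =>
    let ⟨_, _, _, h, _⟩ := hf v w hvw; h
  obtain ⟨B, A, hBA, -, hB⟩ := hf x _ hx
  obtain ⟨B', A', hBA', -, hB'⟩ := hf (f x) _ hx.symm
  rw [hfx] at hBA'
  have hrot := hBA.rotate
  have h1 := hrot.nodup
  have h2 := hBA'.nodup
  have heq := isChain_apply_unique hrot.chain hBA'.chain (nodup_cons.1 h1).1 (nodup_cons.1 h2).1
  rw [heq] at h1
  obtain ⟨rfl, -⟩ := (append_cons_inj_of_notMem (a₁ := x) (a₂ := x) (x₁ := A) (z₁ := B)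
    (x₂ := B') (z₂ := A') (by have := hrot.nodup; simp at this; grind)
    (by have := hrot.nodup; simp at this; grind)).1 heq
  exact ⟨x, f x, A, B, hBA, hx, hB, hB'⟩

theorem isEdgeOrdering_cons {n : ℕ} {G : SimpleGraph (Fin n)} {e : Sym2 (Fin n)}
    {l : List (Sym2 (Fin n))} :
    IsEdgeOrdering G (e :: l) ↔ e ∈ G.edgeSet ∧ IsEdgeOrdering (G.deleteEdges {e}) l := by
  simp only [IsEdgeOrdering, nodup_cons, mem_cons, SimpleGraph.edgeSet_deleteEdges,
    Set.mem_sdiff, Set.mem_singleton_iff]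
  constructor
  · rintro ⟨⟨h1, h2⟩, h3⟩
    refine ⟨(h3 e).1 (.inl rfl), h2, fun a => ?_⟩
    have := h3 a
    grind
  · rintro ⟨h1, h2, h3⟩
    refine ⟨⟨by simp [h3], h2⟩, fun a => ?_⟩
    rw [h3]
    grind

theorem listProd_cons {n : ℕ} (x y : Fin n) (l : List (Sym2 (Fin n))) :
    listProd (s(x, y) :: l) = listProd l * Equiv.swap x y := by
  simp [listProd, edgePerm]

theorem IsEdgeOrdering.hasComponentCycles {n : ℕ} {G : SimpleGraph (Fin n)}
    {l : List (Sym2 (Fin n))} (h : IsEdgeOrdering G l) (hG : G.IsAcyclic) :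
    HasComponentCycles G (listProd l) := by
  induction l generalizing G with
  | nil =>
    have hbot : G = ⊥ := by
      rw [← SimpleGraph.edgeSet_eq_empty]
      ext e
      simp [← h.2 e]
    subst hbot
    refine fun x => ⟨[], by simp, by simp [listProd], fun z => ?_, fun p q r s hs => ?_⟩
    · simp [SimpleGraph.reachable_bot, eq_comm]
    · simp at hs
  | cons e l ih =>
    rw [isEdgeOrdering_cons] at h
    induction e with
    | h x y =>
      rw [listProd_cons]
      refine HasComponentCycles.merge h.1 ?_ (ih h.2 (hG.anti (G.deleteEdges_le _)))
      exact SimpleGraph.isBridge_iff.1 (SimpleGraph.isAcyclic_iff_forall_adj_isBridge.1 hG h.1)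

theorem HasComponentCycles.exists_isEdgeOrdering {n : ℕ} {G : SimpleGraph (Fin n)}
    {c : Equiv.Perm (Fin n)} (h : HasComponentCycles G c) (hG : G.IsAcyclic) :
    ∃ l, IsEdgeOrdering G l ∧ listProd l = c := by
  induction hm : G.edgeSet.ncard using Nat.strong_induction_on generalizing G c with
  | _ m ih =>
    by_cases hadj : ∃ r s, G.Adj r s
    · obtain ⟨r, s, hrs⟩ := hadj
      obtain ⟨x, y, A, B, hc, hxy, hB, hA⟩ := h.exists_mutual_edge hG hrs
      have hlt : (G.deleteEdges {s(x, y)}).edgeSet.ncard < m := by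
        rw [← hm, SimpleGraph.edgeSet_deleteEdges]
        exact Set.ncard_sdiff_singleton_lt_of_mem hxy
      obtain ⟨l, hl, hp⟩ := ih _ hlt (h.split hc hxy hB hA)
        (hG.anti (G.deleteEdges_le _)) rfl
      refine ⟨s(x, y) :: l, isEdgeOrdering_cons.2 ⟨hxy, hl⟩, ?_⟩
      rw [listProd_cons, hp, mul_assoc, Equiv.swap_mul_self, mul_one]
    · have hbot : G = ⊥ := by
        ext a b
        simpa using fun hab => hadj ⟨a, b, hab⟩
      subst hbot
      refine ⟨[], by simp [IsEdgeOrdering], ?_⟩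
      ext1 x
      obtain ⟨A, hA⟩ := h x
      cases A with
      | nil => simpa [listProd, eq_comm] using hA.chain
      | cons a A =>
        have h1 := (hA.mem_iff a).1 (by simp)
        have h2 := hA.nodup
        rw [SimpleGraph.reachable_bot] at h1
        simp [h1] at h2

theorem crossingFree_map_finRange_iff {n : ℕ} {G : SimpleGraph V} {v : Fin n → V} :
    CrossingFree G ((finRange n).map v) ↔ ¬ ∃ a p b q : Fin n, a < p ∧ p < b ∧ b < q ∧
      s(v a, v b) ∈ G.edgeSet ∧ s(v p, v q) ∈ G.edgeSet := by
  constructor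
  · rintro h ⟨a, p, b, q, hap, hpb, hbq, h1, h2⟩
    refine h _ _ _ _ (Sublist.map v (l₁ := [a, p, b, q]) ?_) h1 h2
    refine sublist_of_subperm_of_pairwise (r := (· ≤ ·)) ?_ ?_ ?_
    · refine subperm_of_subset ?_ (by simp)
      simp
      grind
    · simp
      grind
    · exact (sortedLT_finRange n).pairwise.imp le_of_lt
  · intro h p q r s hs hpr hqs
    obtain ⟨l', hl', he⟩ := sublist_map_iff.1 hs
    have hlen := congrArg length he
    rw [length_map] at hlen
    obtain ⟨a, b, d, e, rfl⟩ : ∃ a b d e, l' = [a, b, d, e] := by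
      rcases l' with _ | ⟨a, _ | ⟨b, _ | ⟨d, _ | ⟨e, _ | ⟨f, l⟩⟩⟩⟩⟩ <;> simp at hlen
      exact ⟨a, b, d, e, rfl⟩
    have hp := (sortedLT_finRange n).pairwise.sublist hl'
    simp at he hp
    obtain ⟨rfl, rfl, rfl, rfl⟩ := he
    exact h ⟨a, b, d, e, hp.1.1, hp.2.1.1, hp.2.2, hpr, hqs⟩

theorem pow_card_apply_eq_and_bijective_pow_apply {n : ℕ} {c : Equiv.Perm (Fin n)}
    (hc : ∀ x y : Fin n, ∃ k : ℕ, (c ^ k) x = y) (x : Fin n) :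
    (c ^ n) x = x ∧ Function.Bijective fun k : Fin n => (c ^ k.val) x := by
  have hper : x ∈ Function.periodicPts c :=
    c.injective.mem_periodicPts x
  have hpos := Function.minimalPeriod_pos_of_mem_periodicPts hper
  have hinj : Function.Injective fun k : Fin (Function.minimalPeriod c x) => (c ^ k.val) x := by
    intro a b hab
    simp only [← Equiv.Perm.iterate_eq_pow] at hab
    exact Fin.ext (Function.iterate_injOn_Iio_minimalPeriod a.2 b.2 hab)
  have hsurj : Function.Surjective
      fun k : Fin (Function.minimalPeriod c x) => (c ^ k.val) x := by
    intro y
    obtain ⟨k, hk⟩ := hc x y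
    refine ⟨⟨k % Function.minimalPeriod c x, Nat.mod_lt _ hpos⟩, ?_⟩
    rw [← hk]
    simp only [← Equiv.Perm.iterate_eq_pow]
    exact Function.iterate_mod_minimalPeriod_eq
  have hn : Function.minimalPeriod c x = n := by
    simpa using Fintype.card_of_bijective ⟨hinj, hsurj⟩
  rw [hn] at hinj hsurj
  refine ⟨?_, hinj, hsurj⟩
  have := Function.iterate_minimalPeriod (f := c) (x := x)
  rwa [hn, Equiv.Perm.iterate_eq_pow] at this

theorem exists_orbit_list {n : ℕ} (hn : 0 < n) {c : Equiv.Perm (Fin n)}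
    (hc : ∀ x y : Fin n, ∃ k : ℕ, (c ^ k) x = y) :
    ∃ A, (finRange n).map (fun k => (c ^ k.val) ⟨0, hn⟩) = ⟨0, hn⟩ :: A ∧
      (⟨0, hn⟩ :: A).Nodup ∧ (∀ z, z ∈ (⟨0, hn⟩ : Fin n) :: A) ∧
      ((⟨0, hn⟩ : Fin n) :: (A ++ [⟨0, hn⟩])).IsChain fun a b => c a = b := by
  set x : Fin n := ⟨0, hn⟩ with hx
  clear_value x
  obtain ⟨hper, hbij⟩ := pow_card_apply_eq_and_bijective_pow_apply hc x
  obtain ⟨m, rfl⟩ : ∃ m, n = m + 1 := ⟨n - 1, by omega⟩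
  have hlist : (finRange (m + 1)).map (fun k => (c ^ k.val) x) =
      x :: (finRange m).map (fun k => (c ^ (k.val + 1)) x) := by
    simp [finRange_succ, Function.comp_def]
  refine ⟨_, hlist, ?_, ?_, ?_⟩
  · rw [← hlist]
    exact (nodup_finRange _).map hbij.1
  · intro z
    rw [← hlist]
    obtain ⟨k, hk⟩ := hbij.2 z
    exact mem_map.2 ⟨k, mem_finRange _, hk⟩
  · have : x :: ((finRange m).map (fun k => (c ^ (k.val + 1)) x) ++ [x]) =
        (range (m + 2)).map fun k => (c ^ k) x := by
      rw [range_succ, map_append, map_singleton, hper, ← cons_append, ← hlist,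
        ← map_coe_finRange_eq_range, map_map]
      rfl
    rw [this, isChain_map]
    refine (isChain_range_succ _ (m + 1)).2 fun k _ => ?_
    rw [pow_succ', Equiv.Perm.mul_apply]

end NoncrossingTrees

/-- Theorem 4.1: let `T` be a tree on `{1,…,n}` and `c` an `n`-cycle
(a permutation whose powers act transitively), with `v_k = c^(k-1)(1)` (0-indexed:
`v k = c^k 0`). Then some edge ordering of `T` has product `c` iff the diagram of
`(T, c)` is crossing-free: there are no edges `{v a, v b}` and `{v p, v q}` of `T`
with `a < p < b < q`. -/
theorem stmt18 (n : ℕ) (hn : 0 < n) (T : SimpleGraph (Fin n)) (hT : T.IsTree)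
    (c : Equiv.Perm (Fin n)) (hc : ∀ x y : Fin n, ∃ k : ℕ, (c ^ k) x = y) :
    (∃ l, IsEdgeOrdering T l ∧ listProd l = c) ↔
      ¬∃ a p b q : Fin n, a < p ∧ p < b ∧ b < q ∧
        s((c ^ a.val) ⟨0, hn⟩, (c ^ b.val) ⟨0, hn⟩) ∈ T.edgeSet ∧
        s((c ^ p.val) ⟨0, hn⟩, (c ^ q.val) ⟨0, hn⟩) ∈ T.edgeSet := by
  obtain ⟨A, hA, hnd, hmem, hchain⟩ := exists_orbit_list hn hc
  rw [← crossingFree_map_finRange_iff (v := fun k : Fin n => (c ^ k.val) ⟨0, hn⟩), hA]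
  constructor
  · rintro ⟨l, hl, rfl⟩
    obtain ⟨B, hB⟩ := hl.hasComponentCycles hT.isAcyclic ⟨0, hn⟩
    rw [isChain_apply_unique hchain hB.chain (List.nodup_cons.1 hnd).1
      (List.nodup_cons.1 hB.nodup).1]
    exact hB.crossingFree
  · intro h
    have hcyc : IsComponentCycle T c ⟨0, hn⟩ A :=
      ⟨hnd, hchain, fun z => iff_of_true (hmem z) (hT.connected _ _), h⟩
    exact HasComponentCycles.exists_isEdgeOrdering (fun x => hcyc.exists_of_mem (hmem x))
      hT.isAcyclic
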